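/- For a pure bipartite quantum state |Ψ⟩ ∈ H_A ⊗ H_B, there exist quantum channels C : B(H_A) → B(H_B) and D : B(H_B) → B(H_A) such that (C ⊗ D)(|Ψ⟩⟨Ψ|) = SWAP |Ψ⟩⟨Ψ| SWAP† (where SWAP exchanges the two tensor factors of H_A ⊗ H_B, assuming dim H_A = dim H_B). -/

import Mathlib

open Matrix Kronecker

/-- The swap operator on `H ⊗ H`. -/
def swapMat (d : ℕ) : Matrix (Fin d × Fin d) (Fin d × Fin d) ℂ :=
  fun p q => if p.1 = q.2 ∧ p.2 = q.1 then 1 else 0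

/-- A square matrix whose columns are pairwise orthogonal is a unitary times a diagonal matrix. -/
theorem exists_unitary_mul_diagonal_of_conjTranspose_mul_self {n : Type*} [Fintype n]
    [DecidableEq n] (N : Matrix n n ℂ) (hN : (Nᴴ * N).IsDiag) :
    ∃ W ∈ Matrix.unitaryGroup n ℂ, ∃ s : n → ℂ, N = W * Matrix.diagonal s := by
  let c : n → EuclideanSpace ℂ n := fun j => WithLp.toLp 2 (fun i => N i j)
  have hc : ∀ i j, inner ℂ (c i) (c j) = (Nᴴ * N) i j := fun i j => by
    simp [c, PiLp.inner_apply, Matrix.mul_apply, mul_comm]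
  have hv : Orthonormal ℂ
      ({j | c j ≠ 0}.domRestrict fun j => (((‖c j‖⁻¹ : ℝ) : ℂ) • c j)) := by
    refine ⟨fun j => ?_, fun i j hij => ?_⟩
    · have hj : ‖c j‖ ≠ 0 := norm_ne_zero_iff.mpr j.2
      simp [norm_smul, hj]
    · have hij' : (i : n) ≠ j := fun h => hij (Subtype.ext h)
      simp [inner_smul_left, inner_smul_right, hc, hN hij']
  obtain ⟨b, hb⟩ := hv.exists_orthonormalBasis_extension_of_card_eq (by simp)
  refine ⟨_, (EuclideanSpace.basisFun n ℂ).toMatrix_orthonormalBasis_mem_unitary b,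
    fun j => (‖c j‖ : ℂ), ?_⟩
  ext i j
  have hcb : c j = (‖c j‖ : ℂ) • b j := by
    by_cases hj : c j = 0
    · simp [hj]
    · have hj' : (‖c j‖ : ℂ) ≠ 0 := by simpa using hj
      rw [hb j hj, smul_smul]
      simp [hj']
  have hij : N i j = ‖c j‖ * b j i := congrArg (fun v : EuclideanSpace ℂ n => v i) hcb
  simp [hij, Matrix.mul_diagonal, Module.Basis.toMatrix_apply, mul_comm]

/-- Singular value decomposition of a square complex matrix (with unconstrained diagonal). -/
theorem exists_unitary_mul_diagonal_mul_conjTranspose {n : Type*} [Fintype n] [DecidableEq n]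
    (X : Matrix n n ℂ) :
    ∃ W ∈ Matrix.unitaryGroup n ℂ, ∃ U ∈ Matrix.unitaryGroup n ℂ, ∃ s : n → ℂ,
      X = W * Matrix.diagonal s * Uᴴ := by
  have hX : (Xᴴ * X).IsHermitian := Matrix.isHermitian_conjTranspose_mul_self X
  have hU := hX.eigenvectorUnitary.2
  have hUU : (hX.eigenvectorUnitary : Matrix n n ℂ) * (hX.eigenvectorUnitary : Matrix n n ℂ)ᴴ = 1 :=
    Matrix.mem_unitaryGroup_iff.mp hU
  obtain ⟨W, hW, s, hs⟩ := exists_unitary_mul_diagonal_of_conjTranspose_mul_self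
    (X * (hX.eigenvectorUnitary : Matrix n n ℂ)) (by
      have h := hX.conjStarAlgAut_star_eigenvectorUnitary
      rw [Unitary.conjStarAlgAut_star_apply] at h
      have h' : (X * (hX.eigenvectorUnitary : Matrix n n ℂ))ᴴ *
          (X * (hX.eigenvectorUnitary : Matrix n n ℂ)) =
          Matrix.diagonal (RCLike.ofReal ∘ hX.eigenvalues) := by
        rw [← h, Matrix.conjTranspose_mul, Matrix.star_eq_conjTranspose]
        simp only [Matrix.mul_assoc]
      rw [h']
      exact Matrix.isDiag_diagonal _)
  refine ⟨W, hW, _, hU, s, ?_⟩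
  rw [← hs, Matrix.mul_assoc, hUU, Matrix.mul_one]

/-- Every square complex matrix is unitarily equivalent to its transpose. -/
theorem exists_unitary_mul_mul_transpose_eq_transpose {n : Type*} [Fintype n] [DecidableEq n]
    (X : Matrix n n ℂ) :
    ∃ A ∈ Matrix.unitaryGroup n ℂ, ∃ B ∈ Matrix.unitaryGroup n ℂ, A * X * Bᵀ = Xᵀ := by
  obtain ⟨W, hW, U, hU, s, rfl⟩ := exists_unitary_mul_diagonal_mul_conjTranspose X
  have hW' : Wᴴ * W = 1 := Matrix.mem_unitaryGroup_iff'.mp hW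
  have hU' : Uᴴ * U = 1 := Matrix.mem_unitaryGroup_iff'.mp hU
  have hUT : Uᵀ * Uᴴᵀ = 1 := by rw [← Matrix.transpose_mul, hU', Matrix.transpose_one]
  have hUT' : (Uᵀ)ᴴ = Uᴴᵀ := rfl
  have hUT'' : (Uᴴᵀ)ᴴ = Uᵀ := by rw [← hUT', Matrix.conjTranspose_conjTranspose]
  refine ⟨Uᴴᵀ * Wᴴ, mul_mem ?_ (Unitary.star_mem hW), W * Uᵀ, mul_mem hW ?_, ?_⟩
  · rw [Matrix.mem_unitaryGroup_iff', Matrix.star_eq_conjTranspose, hUT'', hUT]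
  · rw [Matrix.mem_unitaryGroup_iff, Matrix.star_eq_conjTranspose, hUT', hUT]
  · calc Uᴴᵀ * Wᴴ * (W * Matrix.diagonal s * Uᴴ) * (W * Uᵀ)ᵀ
        = Uᴴᵀ * (Wᴴ * W) * Matrix.diagonal s * (Uᴴ * U) * Wᵀ := by
          simp only [Matrix.transpose_mul, Matrix.transpose_transpose, Matrix.mul_assoc]
      _ = (W * Matrix.diagonal s * Uᴴ)ᵀ := by
          simp [hW', hU', Matrix.transpose_mul, Matrix.mul_assoc]

/-- The swap operator exchanges the two indices of a vector. -/
theorem swapMat_mulVec {d : ℕ} (Ψ : Fin d × Fin d → ℂ) : swapMat d *ᵥ Ψ = Ψ ∘ Prod.swap := by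
  ext ⟨i, j⟩
  rw [Matrix.mulVec, dotProduct, Finset.sum_eq_single (j, i)]
  · simp [swapMat]
  · rintro ⟨k, l⟩ - h
    have : ¬(i = l ∧ j = k) := fun ⟨h₁, h₂⟩ => h (by rw [h₁, h₂])
    simp [swapMat, this]
  · simp

/-- Conjugating a rank-one projector applies the operator to the underlying vector. -/
theorem mul_vecMulVec_star_mul_conjTranspose {m n : Type*} [Fintype n]
    (A : Matrix m n ℂ) (v : n → ℂ) :
    A * Matrix.vecMulVec v (star v) * Aᴴ = Matrix.vecMulVec (A *ᵥ v) (star (A *ᵥ v)) := by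
  rw [Matrix.mul_vecMulVec, Matrix.vecMulVec_mul, Matrix.star_mulVec]

/-- Local Exchangeability in quantum theory: for every pure bipartite state `Ψ`
there exist quantum channels `C` (on the first factor) and `D` (on the second),
given here by Kraus operators, such that `(C ⊗ D)(|Ψ⟩⟨Ψ|) = SWAP |Ψ⟩⟨Ψ| SWAPᴴ`. -/
theorem local_exchangeability_quantum {d : ℕ} (Ψ : Fin d × Fin d → ℂ)
    (hΨ : ∑ p, Complex.normSq (Ψ p) = 1) :
    ∃ (k l : ℕ) (K : Fin k → Matrix (Fin d) (Fin d) ℂ)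
      (L : Fin l → Matrix (Fin d) (Fin d) ℂ),
      (∑ i, (K i)ᴴ * K i = 1) ∧ (∑ j, (L j)ᴴ * L j = 1) ∧
      (∑ i, ∑ j, ((K i) ⊗ₖ (L j)) * Matrix.vecMulVec Ψ (star Ψ) * ((K i) ⊗ₖ (L j))ᴴ
        = swapMat d * Matrix.vecMulVec Ψ (star Ψ) * (swapMat d)ᴴ) := by
  obtain ⟨A, hA, B, hB, hAB⟩ :=
    exists_unitary_mul_mul_transpose_eq_transpose (Matrix.of fun j i => Ψ (i, j))
  refine ⟨1, 1, fun _ => B, fun _ => A, ?_, ?_, ?_⟩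
  · simpa [Matrix.star_eq_conjTranspose] using Matrix.mem_unitaryGroup_iff'.mp hB
  · simpa [Matrix.star_eq_conjTranspose] using Matrix.mem_unitaryGroup_iff'.mp hA
  · have hvec : Matrix.vec (Matrix.of fun j i => Ψ (i, j)) = Ψ := rfl
    have hswap : (B ⊗ₖ A) *ᵥ Ψ = swapMat d *ᵥ Ψ := by
      conv_lhs => rw [← hvec]
      rw [Matrix.kronecker_mulVec_vec, hAB, swapMat_mulVec]
      rfl
    simp only [Finset.univ_unique, Finset.sum_singleton]
    rw [mul_vecMulVec_star_mul_conjTranspose, mul_vecMulVec_star_mul_conjTranspose, hswap]
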